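/- arXiv:1112.0779 — 3 statements merged into one kernel-verified Lean document; each statement's English description precedes it below -/
import Mathlib

section
/- The Casimir operator satisfies the quadratic identity Υ² = 2Υ + 3·id on the space of endomorphisms of H; equivalently (Υ − 3·id)∘(Υ + id) = 0, so the spectrum of Υ is contained in {3, −1}. -/
/-- The Casimir operator `Υ(Ψ) = −(I₁ΨI₁ + I₂ΨI₂ + I₃ΨI₃)`. -/
noncomputable def casimir {H : Type*} [AddCommGroup H] [Module ℝ H]
    (I₁ I₂ I₃ Ψ : Module.End ℝ H) : Module.End ℝ H :=
  -(I₁ * Ψ * I₁ + I₂ * Ψ * I₂ + I₃ * Ψ * I₃)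

/-- In any ring, conjugation by a quaternion triple satisfies the Casimir quadratic identity. -/
theorem quaternion_triple_conj_sum_conj_sum {R : Type*} [Ring R] {a b c : R}
    (haa : a * a = -1) (hbb : b * b = -1) (hcc : c * c = -1)
    (hab : a * b = c) (hba : b * a = -c) (x : R) :
    a * (a * x * a + b * x * b + c * x * c) * a + b * (a * x * a + b * x * b + c * x * c) * b
        + c * (a * x * a + b * x * b + c * x * c) * c
      = 3 * x - 2 * (a * x * a + b * x * b + c * x * c) := by
  have hac : a * c = -b := by rw [← hab, ← mul_assoc, haa, neg_one_mul]
  have hcb : c * b = -a := by rw [← hab, mul_assoc, hbb, mul_neg_one]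
  have hbc : b * c = a := by rw [← neg_eq_iff_eq_neg.mpr hba, mul_neg, ← mul_assoc, hbb]; simp
  have hca : c * a = b := by rw [← neg_eq_iff_eq_neg.mpr hba, neg_mul, mul_assoc, haa]; simp
  have expand (p q : R) : p * (q * x * q) * p = p * q * x * (q * p) := by
    simp only [mul_assoc]
  simp only [mul_add, add_mul, expand, haa, hbb, hcc, hab, hba, hac, hca, hbc, hcb]
  noncomm_ring

/-- The Casimir operator satisfies the quadratic identity `Υ² = 2Υ + 3·id` on the
space of endomorphisms of `H`; equivalently `(Υ − 3·id)∘(Υ + id) = 0`, so the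
spectrum of `Υ` is contained in `{3, −1}`. -/
theorem casimir_quadratic_identity
    {H : Type*} [AddCommGroup H] [Module ℝ H]
    (I₁ I₂ I₃ : Module.End ℝ H)
    (h11 : I₁ * I₁ = -1) (h22 : I₂ * I₂ = -1) (h33 : I₃ * I₃ = -1)
    (h12 : I₁ * I₂ = I₃) (h21 : I₂ * I₁ = -I₃) :
    (∀ Ψ : Module.End ℝ H,
        casimir I₁ I₂ I₃ (casimir I₁ I₂ I₃ Ψ) = (2 : ℝ) • casimir I₁ I₂ I₃ Ψ + (3 : ℝ) • Ψ)
    ∧ (∀ Ψ : Module.End ℝ H,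
        casimir I₁ I₂ I₃ (casimir I₁ I₂ I₃ Ψ) - (3 : ℝ) • casimir I₁ I₂ I₃ Ψ
          + (casimir I₁ I₂ I₃ Ψ) - (3 : ℝ) • Ψ = 0) := by
  have key (Ψ : Module.End ℝ H) : casimir I₁ I₂ I₃ (casimir I₁ I₂ I₃ Ψ)
      = (2 : ℝ) • casimir I₁ I₂ I₃ Ψ + (3 : ℝ) • Ψ := by
    have h := quaternion_triple_conj_sum_conj_sum h11 h22 h33 h12 h21 Ψ
    simp only [casimir, mul_neg, neg_mul, ← neg_add, neg_neg]
    rw [h, ofNat_smul_eq_nsmul ℝ 2, ofNat_smul_eq_nsmul ℝ 3]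
    noncomm_ring
  refine ⟨key, fun Ψ => ?_⟩
  rw [key]
  module
end

section
/- For every endomorphism Ψ of H one has the Bessel-type inequality |Ψ_{[-1]}|² ≥ (1/(4n)) · [ (tr(I₁∘Ψ))² + (tr(I₂∘Ψ))² + (tr(I₃∘Ψ))² ]. -/
open RealInnerProductSpace

/-- The trace (Frobenius) inner product `⟨A, B⟩ = tr(Aᵀ∘B)` on endomorphisms. -/
noncomputable def tinner {H : Type*} [NormedAddCommGroup H] [InnerProductSpace ℝ H]
    [FiniteDimensional ℝ H] (A B : Module.End ℝ H) : ℝ :=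
  LinearMap.trace ℝ H (LinearMap.adjoint A ∘ₗ B)

/-- `Ψ_{[-1]}` -/
noncomputable def partMinusOne {H : Type*} [AddCommGroup H] [Module ℝ H]
    (I₁ I₂ I₃ Ψ : Module.End ℝ H) : Module.End ℝ H :=
  (4 : ℝ)⁻¹ • ((3 : ℝ) • Ψ + I₁ * Ψ * I₁ + I₂ * Ψ * I₂ + I₃ * Ψ * I₃)

section Trace

variable {H : Type*} [NormedAddCommGroup H] [InnerProductSpace ℝ H] [FiniteDimensional ℝ H]

/-- The adjoint of a linear map has the same trace. -/
lemma trace_adjoint_real (A : Module.End ℝ H) :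
    LinearMap.trace ℝ H (LinearMap.adjoint A) = LinearMap.trace ℝ H A := by
  rw [LinearMap.trace_eq_sum_inner _ (stdOrthonormalBasis ℝ H),
    LinearMap.trace_eq_sum_inner _ (stdOrthonormalBasis ℝ H)]
  refine Finset.sum_congr rfl fun i _ => ?_
  rw [LinearMap.adjoint_inner_right, real_inner_comm]

lemma tinner_self_nonneg (A : Module.End ℝ H) : 0 ≤ tinner A A := by
  rw [tinner, LinearMap.trace_eq_sum_inner _ (stdOrthonormalBasis ℝ H)]
  refine Finset.sum_nonneg fun i _ => ?_
  rw [LinearMap.comp_apply, LinearMap.adjoint_inner_right]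
  exact real_inner_self_nonneg

/-- An orthogonal complex structure is skew-adjoint. -/
lemma adjoint_eq_neg_of_orthogonal {I : Module.End ℝ H}
    (ho : ∀ x y : H, ⟪I x, I y⟫ = ⟪x, y⟫) (hsq : I * I = -1) :
    LinearMap.adjoint I = -I := by
  symm
  rw [LinearMap.eq_adjoint_iff]
  intro x y
  have h : I (I x) = -x := by simpa using LinearMap.congr_fun hsq x
  have := ho (I x) y
  rw [h] at this
  simp only [LinearMap.neg_apply, inner_neg_left] at this ⊢
  linarith

/-- For skew-adjoint `I`, the traces of `A* I` and `I A` are opposite. -/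
lemma trace_adjoint_mul_of_skew {I : Module.End ℝ H} (hI : LinearMap.adjoint I = -I)
    (A : Module.End ℝ H) :
    LinearMap.trace ℝ H (LinearMap.adjoint A * I) = -LinearMap.trace ℝ H (I * A) := by
  rw [← trace_adjoint_real (I * A), Module.End.mul_eq_comp I A, LinearMap.adjoint_comp, hI,
    ← Module.End.mul_eq_comp, mul_neg, map_neg, neg_neg]

end Trace

/-- Taking the `[-1]`-component does not change the trace against `J` when `J` itself
lies in the `[-1]`-component. -/
lemma trace_mul_partMinusOne {H : Type*} [AddCommGroup H] [Module ℝ H]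
    {I₁ I₂ I₃ J : Module.End ℝ H} (hJ : partMinusOne I₁ I₂ I₃ J = J) (Ψ : Module.End ℝ H) :
    LinearMap.trace ℝ H (J * partMinusOne I₁ I₂ I₃ Ψ) = LinearMap.trace ℝ H (J * Ψ) := by
  have cyc (K : Module.End ℝ H) :
      LinearMap.trace ℝ H (J * (K * Ψ * K)) = LinearMap.trace ℝ H (K * J * K * Ψ) := by
    rw [← mul_assoc, LinearMap.trace_mul_comm]
    simp only [mul_assoc]
  conv_rhs => rw [← hJ]
  simp only [partMinusOne, mul_smul_comm, smul_mul_assoc, mul_add, add_mul, map_smul, map_add, cyc]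

/-- For every endomorphism `Ψ` of `H` one has the Bessel-type inequality
`|Ψ_{[-1]}|² ≥ (1/(4n)) · [ (tr(I₁∘Ψ))² + (tr(I₂∘Ψ))² + (tr(I₃∘Ψ))² ]`. -/
theorem partMinusOne_bessel
    {H : Type*} [NormedAddCommGroup H] [InnerProductSpace ℝ H] [FiniteDimensional ℝ H]
    (n : ℕ) (hn : 1 ≤ n) (hdim : Module.finrank ℝ H = 4 * n)
    (I₁ I₂ I₃ : Module.End ℝ H)
    (ho1 : ∀ x y : H, ⟪I₁ x, I₁ y⟫ = ⟪x, y⟫)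
    (ho2 : ∀ x y : H, ⟪I₂ x, I₂ y⟫ = ⟪x, y⟫)
    (ho3 : ∀ x y : H, ⟪I₃ x, I₃ y⟫ = ⟪x, y⟫)
    (h11 : I₁ * I₁ = -1) (h22 : I₂ * I₂ = -1) (h33 : I₃ * I₃ = -1)
    (h12 : I₁ * I₂ = I₃) (h21 : I₂ * I₁ = -I₃)
    (Ψ : Module.End ℝ H) :
    tinner (partMinusOne I₁ I₂ I₃ Ψ) (partMinusOne I₁ I₂ I₃ Ψ)
      ≥ (1 / (4 * n)) *
        ((LinearMap.trace ℝ H (I₁ ∘ₗ Ψ)) ^ 2 + (LinearMap.trace ℝ H (I₂ ∘ₗ Ψ)) ^ 2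
          + (LinearMap.trace ℝ H (I₃ ∘ₗ Ψ)) ^ 2) := by
  have h31 : I₃ * I₁ = I₂ := by
    rw [← h12, mul_assoc, h21, ← h12, mul_neg, ← mul_assoc, h11]; simp
  have h13 : I₁ * I₃ = -I₂ := by
    rw [← h12, ← mul_assoc, h11]; simp
  have h23 : I₂ * I₃ = I₁ := by
    rw [← h12, ← mul_assoc, h21, ← h12, neg_mul, mul_assoc, h22]; simp
  have h32 : I₃ * I₂ = -I₁ := by
    rw [← h12, mul_assoc, h22]; simp
  have hp1 : partMinusOne I₁ I₂ I₃ I₁ = I₁ := by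
    simp only [partMinusOne, h11, h21, h31, neg_mul, h23, h32, one_mul]
    module
  have hp2 : partMinusOne I₁ I₂ I₃ I₂ = I₂ := by
    simp only [partMinusOne, h12, h22, h32, neg_mul, h31, h13, one_mul]
    module
  have hp3 : partMinusOne I₁ I₂ I₃ I₃ = I₃ := by
    simp only [partMinusOne, h13, h23, h33, neg_mul, h21, h12, one_mul]
    module
  have z3 : LinearMap.trace ℝ H I₃ = 0 := by
    have := LinearMap.trace_mul_comm ℝ I₁ I₂
    rw [h12, h21, map_neg] at this
    linarith
  have z2 : LinearMap.trace ℝ H I₂ = 0 := by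
    have := LinearMap.trace_mul_comm ℝ I₃ I₁
    rw [h31, h13, map_neg] at this
    linarith
  have z1 : LinearMap.trace ℝ H I₁ = 0 := by
    have := LinearMap.trace_mul_comm ℝ I₂ I₃
    rw [h23, h32, map_neg] at this
    linarith
  have a1 := adjoint_eq_neg_of_orthogonal ho1 h11
  have a2 := adjoint_eq_neg_of_orthogonal ho2 h22
  have a3 := adjoint_eq_neg_of_orthogonal ho3 h33
  have hone : LinearMap.trace ℝ H 1 = 4 * n := by
    rw [LinearMap.trace_one, hdim]; push_cast; rfl
  have hn0 : (n : ℝ) ≠ 0 := by positivity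
  simp only [← Module.End.mul_eq_comp]
  rw [← trace_mul_partMinusOne hp1 Ψ, ← trace_mul_partMinusOne hp2 Ψ,
    ← trace_mul_partMinusOne hp3 Ψ]
  generalize partMinusOne I₁ I₂ I₃ Ψ = Φ
  have expand (c₁ c₂ c₃ : ℝ) :
      tinner (Φ + c₁ • I₁ + c₂ • I₂ + c₃ • I₃) (Φ + c₁ • I₁ + c₂ • I₂ + c₃ • I₃) =
        tinner Φ Φ - 2 * (c₁ * LinearMap.trace ℝ H (I₁ * Φ) + c₂ * LinearMap.trace ℝ H (I₂ * Φ)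
          + c₃ * LinearMap.trace ℝ H (I₃ * Φ)) + 4 * n * (c₁ ^ 2 + c₂ ^ 2 + c₃ ^ 2) := by
    simp only [tinner, ← Module.End.mul_eq_comp, map_add, map_smulₛₗ, a1, a2, a3, add_mul, mul_add,
      smul_mul_assoc, mul_smul_comm, neg_mul, smul_neg, map_neg, h11, h22, h33, h12, h21, h13, h31,
      h23, h32, z1, z2, z3, hone, trace_adjoint_mul_of_skew a1, trace_adjoint_mul_of_skew a2,
      trace_adjoint_mul_of_skew a3, smul_eq_mul, conj_trivial, RingHom.id_apply]
    ring
  have key := tinner_self_nonneg (Φ + (LinearMap.trace ℝ H (I₁ * Φ) / (4 * n)) • I₁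
    + (LinearMap.trace ℝ H (I₂ * Φ) / (4 * n)) • I₂
    + (LinearMap.trace ℝ H (I₃ * Φ) / (4 * n)) • I₃)
  rw [expand] at key
  rw [ge_iff_le, ← sub_nonneg]
  convert key using 1
  field_simp
  ring
end

section
/- Let n > 1. For every smooth compactly supported function f : ℝ^{4n+3} → ℝ, the full horizontal second derivatives are controlled by the sub-Laplacian in L²: Σ_{b,c=1}^{4n} ∫_{ℝ^{4n+3}} (e_b(e_c f))² dV ≤ (1 + 1/n) ∫_{ℝ^{4n+3}} ( Σ_{b=1}^{4n} e_b(e_b f) )² dV; equivalently ‖∇²f‖_{L²} ≤ √(1 + 1/n) · ‖Δf‖_{L²}, where Δf = −Σ_b e_b(e_b f) and |∇²f|² = Σ_{b,c}(e_b(e_c f))². -/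
open MeasureTheory

/-- The quaternionic Heisenberg group of dimension `4n+3`, identified with
`ℝ^{4n+3}` via the coordinates `(tᵃ, xᵃ, yᵃ, zᵃ)_{a=1,…,n}` (grouped as four
families of `n` coordinates, indexed by `Fin 4 × Fin n` via `p.1 i a`) together
with the three vertical coordinates `(ω₁, ω₂, ω₃) = p.2`. -/
abbrev QH (n : ℕ) := (Fin 4 → Fin n → ℝ) × (Fin 3 → ℝ)

/-- The value at the point `p` of the standard left-invariant horizontal vector
field of the quaternionic Heisenberg group with label `(i, a) : Fin 4 × Fin n`,
where `i = 0,1,2,3` corresponds to `T_a, X_a, Y_a, Z_a` respectively: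
`T_a = ∂_{tᵃ} + 2xᵃ∂_{ω₁} + 2yᵃ∂_{ω₂} + 2zᵃ∂_{ω₃}`,
`X_a = ∂_{xᵃ} − 2tᵃ∂_{ω₁} − 2zᵃ∂_{ω₂} + 2yᵃ∂_{ω₃}`,
`Y_a = ∂_{yᵃ} + 2zᵃ∂_{ω₁} − 2tᵃ∂_{ω₂} − 2xᵃ∂_{ω₃}`,
`Z_a = ∂_{zᵃ} − 2yᵃ∂_{ω₁} + 2xᵃ∂_{ω₂} − 2tᵃ∂_{ω₃}`. -/
noncomputable def horVF {n : ℕ} (i : Fin 4) (a : Fin n) (p : QH n) : QH n :=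
  ((fun j b => if j = i ∧ b = a then (1 : ℝ) else 0),
    if i = 0 then ![2 * p.1 1 a, 2 * p.1 2 a, 2 * p.1 3 a]
    else if i = 1 then ![-2 * p.1 0 a, -2 * p.1 3 a, 2 * p.1 2 a]
    else if i = 2 then ![2 * p.1 3 a, -2 * p.1 0 a, -2 * p.1 1 a]
    else ![-2 * p.1 2 a, 2 * p.1 1 a, -2 * p.1 0 a])

/-- The horizontal vector field with label `(i, a)`, viewed as a first-order
differential operator `e_{(i,a)}` acting on functions on the quaternionic
Heisenberg group. -/
noncomputable def horDeriv {n : ℕ} (i : Fin 4) (a : Fin n) (f : QH n → ℝ) :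
    QH n → ℝ :=
  fun p => fderiv ℝ f p (horVF i a p)

section Abstract

variable {M ι S : Type*} [AddCommGroup M] [Module ℝ M] [Fintype ι] [Fintype S] [DecidableEq S]
  {E : ι → M → M} {V : S → M → M} {K : S → ι → ι → ℝ} {N : ℝ}

/-- Contracting second derivatives with a skew structure recovers the vertical derivative. -/
theorem sum_smul_comp_eq_vertical
    (hskew : ∀ s b c, K s b c = -K s c b)
    (horth : ∀ s r, ∑ b, ∑ c, K s b c * K r b c = if s = r then N else 0)
    (hcomm : ∀ b c x, E b (E c x) - E c (E b x) = (4 : ℝ) • ∑ s, K s b c • V s x)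
    (s : S) (x : M) :
    ∑ b, ∑ c, K s b c • E b (E c x) = (2 * N) • V s x := by
  have hdouble : (2 : ℝ) • ∑ b, ∑ c, K s b c • E b (E c x) = (4 * N) • V s x := by
    calc (2 : ℝ) • ∑ b, ∑ c, K s b c • E b (E c x)
        = ∑ b, ∑ c, K s b c • E b (E c x) + ∑ b, ∑ c, K s c b • E c (E b x) := by
          rw [two_smul]
          congr 1
          exact Finset.sum_comm
      _ = ∑ b, ∑ c, ∑ r, (4 * (K s b c * K r b c)) • V r x := by
          rw [← Finset.sum_add_distrib]
          refine Finset.sum_congr rfl fun b _ => ?_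
          rw [← Finset.sum_add_distrib]
          refine Finset.sum_congr rfl fun c _ => ?_
          rw [hskew s c b, neg_smul, ← sub_eq_add_neg, ← smul_sub, hcomm, Finset.smul_sum,
            Finset.smul_sum]
          refine Finset.sum_congr rfl fun r _ => ?_
          simp only [smul_smul]
          congr 1
          ring
      _ = ∑ r, (4 * ∑ b, ∑ c, K s b c * K r b c) • V r x := by
          simp_rw [Finset.mul_sum, Finset.sum_smul]
          rw [Finset.sum_comm]
          conv_rhs => rw [Finset.sum_comm]
          rw [Finset.sum_comm]
          refine Finset.sum_congr rfl fun b _ => Finset.sum_comm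
      _ = (4 * N) • V s x := by
          simp [horth]
  have := congrArg (fun y => (1 / 2 : ℝ) • y) hdouble
  simp only [smul_smul] at this
  norm_num at this
  rw [this]
  congr 1
  ring

variable (B : M →ₗ[ℝ] M →ₗ[ℝ] ℝ) (E : ι → M →ₗ[ℝ] M) (V : S → M → M)

/-- Bochner-type identity for the full Hessian. -/
theorem sum_hessian_sq_eq
    (hE : ∀ b x y, B (E b x) y = -B x (E b y))
    (hskew : ∀ s b c, K s b c = -K s c b)
    (horth : ∀ s r, ∑ b, ∑ c, K s b c * K r b c = if s = r then N else 0)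
    (hcomm : ∀ b c x, E b (E c x) - E c (E b x) = (4 : ℝ) • ∑ s, K s b c • V s x)
    (hV : ∀ s b x, V s (E b x) = E b (V s x)) (f : M) :
    ∑ b, ∑ c, B (E b (E c f)) (E b (E c f)) =
      B (∑ b, E b (E b f)) (∑ b, E b (E b f)) + 16 * N * ∑ s, B (V s f) (V s f) := by
  have hswap (b c : ι) : E b (E b (E c f)) =
      E c (E b (E b f)) + (8 : ℝ) • ∑ s, K s b c • E b (V s f) := by
    have h1 := hcomm b c f
    have h2 := hcomm b c (E b f)
    rw [sub_eq_iff_eq_add] at h1 h2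
    rw [h1, map_add, h2]
    simp only [map_smul, map_sum, hV]
    module
  have hterm (b c : ι) : B (E b (E c f)) (E b (E c f)) =
      B (E c (E c f)) (E b (E b f)) + ∑ s, 8 * B (K s b c • E b (E c f)) (V s f) := by
    rw [hE, hswap, map_add, neg_add, ← hE]
    congr 1
    simp only [map_smul, map_sum, smul_eq_mul, LinearMap.smul_apply, Finset.mul_sum, hE,
      ← Finset.sum_neg_distrib]
    refine Finset.sum_congr rfl fun s _ => ?_
    ring
  simp_rw [hterm, Finset.sum_add_distrib]
  congr 1
  · simp only [map_sum, LinearMap.sum_apply]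
  · have hD := sum_smul_comp_eq_vertical (E := fun b => E b) hskew horth hcomm
    calc ∑ b, ∑ c, ∑ s, 8 * B (K s b c • E b (E c f)) (V s f)
        = ∑ s, 8 * B (∑ b, ∑ c, K s b c • E b (E c f)) (V s f) := by
          simp only [map_sum, LinearMap.sum_apply, Finset.mul_sum]
          conv_rhs => rw [Finset.sum_comm]
          refine Finset.sum_congr rfl fun b _ => Finset.sum_comm
      _ = 16 * N * ∑ s, B (V s f) (V s f) := by
          simp only [hD, map_smul, LinearMap.smul_apply, smul_eq_mul, Finset.mul_sum]
          refine Finset.sum_congr rfl fun s _ => ?_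
          ring

/-- Pairing the Hessian with its rotation by one of the skew structures. -/
theorem sum_hessian_rotated_eq
    (hE : ∀ b x y, B (E b x) y = -B x (E b y))
    (hskew : ∀ s b c, K s b c = -K s c b)
    (horth : ∀ s r, ∑ b, ∑ c, K s b c * K r b c = if s = r then N else 0)
    (hcomm : ∀ b c x, E b (E c x) - E c (E b x) = (4 : ℝ) • ∑ s, K s b c • V s x)
    (hV : ∀ s b x, V s (E b x) = E b (V s x)) (s : S) (f : M) :
    ∑ b, ∑ c, B (E b (E c f)) (∑ b', ∑ c', (K s b b' * K s c c') • E b' (E c' f)) =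
      -(4 * N ^ 2 * B (V s f) (V s f)) := by
  have hD := sum_smul_comp_eq_vertical (E := fun b => E b) hskew horth hcomm
  have hinner (c : ι) :
      ∑ b, B (E b (E c f)) (∑ b', ∑ c', (K s b b' * K s c c') • E b' (E c' f)) =
        -(2 * N) * B (∑ c', K s c' c • E c' (E c f)) (V s f) := by
    calc ∑ b, B (E b (E c f)) (∑ b', ∑ c', (K s b b' * K s c c') • E b' (E c' f))
        = -∑ c', K s c c' * B (E c f) (∑ b, ∑ b', K s b b' • E b (E b' (E c' f))) := by
          simp_rw [hE _ (E c f)]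
          simp only [map_sum, map_smul, smul_eq_mul, Finset.mul_sum, Finset.sum_neg_distrib]
          congr 1
          conv_rhs => rw [Finset.sum_comm]
          refine Finset.sum_congr rfl fun b _ => ?_
          conv_rhs => rw [Finset.sum_comm]
          refine Finset.sum_congr rfl fun b' _ => Finset.sum_congr rfl fun c' _ => ?_
          ring
      _ = -(2 * N) * B (∑ c', K s c' c • E c' (E c f)) (V s f) := by
          simp only [hD, hV, map_sum, map_smul, smul_eq_mul, LinearMap.sum_apply,
            LinearMap.smul_apply, Finset.mul_sum, ← Finset.sum_neg_distrib]
          refine Finset.sum_congr rfl fun c' _ => ?_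
          rw [hE c' (E c f), hskew s c' c]
          ring
  rw [Finset.sum_comm]
  simp_rw [hinner]
  rw [← Finset.mul_sum, ← LinearMap.sum_apply, ← map_sum, Finset.sum_comm, hD]
  simp only [map_smul, LinearMap.smul_apply, smul_eq_mul]
  ring

/-- A trace bound for the Hessian averaged over the skew structures yields the estimate. -/
theorem sum_hessian_sq_le {n : ℕ} (hn : 1 < n)
    (hE : ∀ b x y, B (E b x) y = -B x (E b y))
    (hskew : ∀ s b c, K s b c = -K s c b)
    (horth : ∀ s r, ∑ b, ∑ c, K s b c * K r b c = if s = r then 4 * (n : ℝ) else 0)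
    (hcomm : ∀ b c x, E b (E c x) - E c (E b x) = (4 : ℝ) • ∑ s, K s b c • V s x)
    (hV : ∀ s b x, V s (E b x) = E b (V s x)) (f : M)
    (htrace : B (∑ b, E b (E b f)) (∑ b, E b (E b f)) ≤
      n * ∑ b, ∑ c, B (E b (E c f)) (E b (E c f) +
        ∑ s, ∑ b', ∑ c', (K s b b' * K s c c') • E b' (E c' f))) :
    ∑ b, ∑ c, B (E b (E c f)) (E b (E c f)) ≤
      (1 + 1 / (n : ℝ)) * B (∑ b, E b (E b f)) (∑ b, E b (E b f)) := by
  have hsq := sum_hessian_sq_eq B E V hE hskew horth hcomm hV f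
  have hrot := sum_hessian_rotated_eq B E V hE hskew horth hcomm hV
  have hsum : ∑ b, ∑ c, B (E b (E c f)) (E b (E c f) +
        ∑ s, ∑ b', ∑ c', (K s b b' * K s c c') • E b' (E c' f)) =
      ∑ b, ∑ c, B (E b (E c f)) (E b (E c f)) - 64 * n ^ 2 * ∑ s, B (V s f) (V s f) := by
    simp_rw [map_add, Finset.sum_add_distrib, sub_eq_add_neg]
    congr 1
    calc ∑ b, ∑ c, B (E b (E c f)) (∑ s, ∑ b', ∑ c', (K s b b' * K s c c') • E b' (E c' f))
        = ∑ s, ∑ b, ∑ c, B (E b (E c f)) (∑ b', ∑ c', (K s b b' * K s c c') • E b' (E c' f)) := by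
          conv_rhs => rw [Finset.sum_comm]
          refine Finset.sum_congr rfl fun b _ => ?_
          rw [Finset.sum_comm]
          exact Finset.sum_congr rfl fun c _ => map_sum _ _ _
      _ = -(64 * n ^ 2 * ∑ s, B (V s f) (V s f)) := by
          simp_rw [hrot, Finset.mul_sum, ← Finset.sum_neg_distrib]
          refine Finset.sum_congr rfl fun s _ => ?_
          ring
  rw [hsum, hsq] at htrace
  rw [hsq]
  generalize B (∑ b, E b (E b f)) (∑ b, E b (E b f)) = D at *
  generalize ∑ s, B (V s f) (V s f) = v at *
  have hn' : (1 : ℝ) < n := by exact_mod_cast hn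
  have hv : 64 * (n : ℝ) ^ 2 * v ≤ D := by
    have : 0 ≤ ((n : ℝ) - 1) * (D - 64 * (n : ℝ) ^ 2 * v) := by nlinarith
    have := nonneg_of_mul_nonneg_right this (by linarith)
    linarith
  have : 64 * (n : ℝ) * v ≤ D / n := by
    rw [le_div_iff₀ (by linarith)]
    linarith
  calc D + 16 * (4 * (n : ℝ)) * v = D + 64 * n * v := by ring
    _ ≤ D + D / n := by gcongr
    _ = (1 + 1 / (n : ℝ)) * D := by ring

end Abstract

/-- The three complex structures `[e_{(i,a)}, e_{(j,a)}] = 4 ∑ s, quatJ s i j ∂_{ω_s}`. -/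
noncomputable def quatJ : Fin 3 → Fin 4 → Fin 4 → ℝ :=
  ![![![0, -1, 0, 0], ![1, 0, 0, 0], ![0, 0, 0, -1], ![0, 0, 1, 0]],
    ![![0, 0, -1, 0], ![0, 0, 0, 1], ![1, 0, 0, 0], ![0, -1, 0, 0]],
    ![![0, 0, 0, -1], ![0, 0, -1, 0], ![0, 1, 0, 0], ![1, 0, 0, 0]]]

theorem quatJ_skew (s : Fin 3) (i j : Fin 4) : quatJ s i j = -quatJ s j i := by
  fin_cases s <;> fin_cases i <;> fin_cases j <;> simp [quatJ]

theorem quatJ_orthogonal (s r : Fin 3) :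
    ∑ i, ∑ j, quatJ s i j * quatJ r i j = if s = r then 4 else 0 := by
  fin_cases s <;> fin_cases r <;> simp [quatJ, Fin.sum_univ_succ] <;> norm_num

theorem trace_sq_le (m : Fin 4 → Fin 4 → ℝ) :
    (∑ i, m i i) ^ 2 ≤
      ∑ i, ∑ j, m i j * (m i j + ∑ s, ∑ i', ∑ j', quatJ s i i' * quatJ s j j' * m i' j') := by
  have h : ∑ i, ∑ j,
        m i j * (m i j + ∑ s, ∑ i', ∑ j', quatJ s i i' * quatJ s j j' * m i' j') =
      (∑ i, m i i) ^ 2 + (m 0 1 - m 1 0 - m 2 3 + m 3 2) ^ 2 +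
        (m 0 2 - m 2 0 + m 1 3 - m 3 1) ^ 2 + (m 0 3 - m 3 0 - m 1 2 + m 2 1) ^ 2 := by
    simp [quatJ, Fin.sum_univ_four, Fin.sum_univ_three]
    ring
  rw [h]
  nlinarith [sq_nonneg (m 0 1 - m 1 0 - m 2 3 + m 3 2), sq_nonneg (m 0 2 - m 2 0 + m 1 3 - m 3 1),
    sq_nonneg (m 0 3 - m 3 0 - m 1 2 + m 2 1)]

/-- The complex structures acting on all `n` quaternionic coordinates simultaneously. -/
noncomputable def horJ {n : ℕ} (s : Fin 3) (b c : Fin 4 × Fin n) : ℝ :=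
  if b.2 = c.2 then quatJ s b.1 c.1 else 0

theorem horJ_skew {n : ℕ} (s : Fin 3) (b c : Fin 4 × Fin n) : horJ s b c = -horJ s c b := by
  unfold horJ
  rw [quatJ_skew]
  simp only [eq_comm (a := c.2)]
  split_ifs <;> simp

theorem horJ_orthogonal {n : ℕ} (s r : Fin 3) :
    ∑ b : Fin 4 × Fin n, ∑ c, horJ s b c * horJ r b c = if s = r then 4 * (n : ℝ) else 0 := by
  have h (i : Fin 4) (a : Fin n) :
      ∑ c, horJ s (i, a) c * horJ r (i, a) c = ∑ j, quatJ s i j * quatJ r i j := by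
    simp [horJ, Fintype.sum_prod_type]
  simp_rw [Fintype.sum_prod_type (f := fun b : Fin 4 × Fin n => ∑ c, horJ s b c * horJ r b c), h]
  simp only [Finset.sum_const, Finset.card_univ, Fintype.card_fin, nsmul_eq_mul,
    ← Finset.mul_sum, quatJ_orthogonal]
  split_ifs <;> ring

theorem sum_trace_sq_le {n : ℕ} (h : Fin 4 × Fin n → Fin 4 × Fin n → ℝ) :
    (∑ b, h b b) ^ 2 ≤
      n * ∑ b, ∑ c, h b c * (h b c + ∑ s, ∑ b', ∑ c', horJ s b b' * horJ s c c' * h b' c') := by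
  let m (a b : Fin n) (i j : Fin 4) : ℝ := h (i, a) (j, b)
  let Q (a b : Fin n) : ℝ := ∑ i, ∑ j,
    m a b i j * (m a b i j + ∑ s, ∑ i', ∑ j', quatJ s i i' * quatJ s j j' * m a b i' j')
  have hQ : ∑ b, ∑ c, h b c * (h b c + ∑ s, ∑ b', ∑ c', horJ s b b' * horJ s c c' * h b' c') =
      ∑ a, ∑ b, Q a b := by
    have hrot (i j : Fin 4) (a b : Fin n) (s : Fin 3) :
        ∑ b', ∑ c', horJ s (i, a) b' * horJ s (j, b) c' * h b' c' =
          ∑ i', ∑ j', quatJ s i i' * quatJ s j j' * m a b i' j' := by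
      simp [horJ, Fintype.sum_prod_type, m]
    rw [Fintype.sum_prod_type_right]
    refine Finset.sum_congr rfl fun a _ => ?_
    rw [Finset.sum_comm, Fintype.sum_prod_type_right]
    refine Finset.sum_congr rfl fun b _ => ?_
    rw [Finset.sum_comm]
    simp only [hrot, Q, m]
  have hnonneg (a b : Fin n) : 0 ≤ Q a b := (sq_nonneg _).trans (trace_sq_le (m a b))
  rw [hQ, Fintype.sum_prod_type_right]
  calc (∑ a, ∑ i, m a a i i) ^ 2 ≤ n * ∑ a, (∑ i, m a a i i) ^ 2 := by
        simpa using sq_sum_le_card_mul_sum_sq (s := Finset.univ) (f := fun a => ∑ i, m a a i i)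
    _ ≤ n * ∑ a, ∑ b, Q a b := by
        gcongr with a
        exact (trace_sq_le (m a a)).trans
          (Finset.single_le_sum (fun b _ => hnonneg a b) (Finset.mem_univ a))

section VectorFields

variable {F : Type*} [NormedAddCommGroup F] [NormedSpace ℝ F]

theorem fderiv_fderiv_apply {f : F → ℝ} (hf : ContDiff ℝ (⊤ : ℕ∞) f) {w : F → F} {L : F →L[ℝ] F}
    {p : F} (hw : HasFDerivAt w L p) (u : F) :
    fderiv ℝ (fun q => fderiv ℝ f q (w q)) p u =
      fderiv ℝ (fderiv ℝ f) p u (w p) + fderiv ℝ f p (L u) := by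
  have h1 : HasFDerivAt (fderiv ℝ f) (fderiv ℝ (fderiv ℝ f) p) p :=
    ((hf.fderiv_right (m := (⊤ : ℕ∞)) le_rfl).differentiable (by simp) p).hasFDerivAt
  rw [(h1.clm_apply hw).fderiv]
  simp [add_comm]

theorem fderiv_commutator {f : F → ℝ} (hf : ContDiff ℝ (⊤ : ℕ∞) f) {w₁ w₂ : F → F}
    {L₁ L₂ : F →L[ℝ] F} {p : F} (hw₁ : HasFDerivAt w₁ L₁ p) (hw₂ : HasFDerivAt w₂ L₂ p) :
    fderiv ℝ (fun q => fderiv ℝ f q (w₂ q)) p (w₁ p) -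
        fderiv ℝ (fun q => fderiv ℝ f q (w₁ q)) p (w₂ p) =
      fderiv ℝ f p (L₂ (w₁ p) - L₁ (w₂ p)) := by
  have hsymm : IsSymmSndFDerivAt ℝ f p := hf.contDiffAt.isSymmSndFDerivAt (by
    simpa using WithTop.coe_le_coe.2 (le_top : (2 : ℕ∞) ≤ ⊤))
  rw [fderiv_fderiv_apply hf hw₁, fderiv_fderiv_apply hf hw₂, hsymm.eq, map_sub]
  ring

variable [MeasurableSpace F] [BorelSpace F] [FiniteDimensional ℝ F] (μ : Measure F)
  [μ.IsAddHaarMeasure]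

theorem integral_mul_fderiv_eq_zero {α f : F → ℝ} (hα : ContDiff ℝ (⊤ : ℕ∞) α)
    (hf : ContDiff ℝ (⊤ : ℕ∞) f) (hsupp : HasCompactSupport f) (v : F)
    (hαv : ∀ p, fderiv ℝ α p v = 0) :
    ∫ p, α p * fderiv ℝ f p v ∂μ = 0 := by
  have hf' : Continuous fun p => fderiv ℝ f p v :=
    (hf.continuous_fderiv (by simp)).clm_apply continuous_const
  rw [integral_mul_fderiv_eq_neg_fderiv_mul_of_integrable]
  · simp [hαv]
  · simp [hαv]
  · exact (hα.continuous.mul hf').integrable_of_hasCompactSupport (hsupp.fderiv_apply ℝ v).mul_left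
  · exact (hα.continuous.mul hf.continuous).integrable_of_hasCompactSupport hsupp.mul_left
  · exact fun p _ => hα.differentiable (by simp) p
  · exact fun p _ => hf.differentiable (by simp) p

end VectorFields

section Heisenberg

variable {n : ℕ}

/-- The vertical coefficient of a horizontal vector field, as a function of the point. -/
noncomputable def horCoeff (s : Fin 3) (i : Fin 4) (a : Fin n) (p : QH n) : ℝ :=
  -2 * ∑ j, quatJ s i j * p.1 j a

theorem horVF_eq (i : Fin 4) (a : Fin n) (p : QH n) :
    horVF i a p =
      (fun j b => if j = i ∧ b = a then (1 : ℝ) else 0, fun s => horCoeff s i a p) := by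
  refine Prod.ext rfl (funext fun s => ?_)
  fin_cases i <;> fin_cases s <;> simp [horVF, horCoeff, quatJ, Fin.sum_univ_four]

/-- The linear part of a horizontal vector field. -/
noncomputable def horLin (i : Fin 4) (a : Fin n) : QH n →L[ℝ] QH n :=
  LinearMap.toContinuousLinearMap
    { toFun := fun p => (0, fun s => horCoeff s i a p)
      map_add' := fun p q => by
        refine Prod.ext (by simp) (funext fun s => ?_)
        simp [horCoeff, mul_add, Finset.sum_add_distrib]
      map_smul' := fun r p => by
        refine Prod.ext (by simp) (funext fun s => ?_)
        simp only [horCoeff, Finset.mul_sum, Prod.smul_fst, Prod.smul_snd, Pi.smul_apply,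
          smul_eq_mul, RingHom.id_apply]
        exact Finset.sum_congr rfl fun j _ => by ring }

theorem horLin_apply (i : Fin 4) (a : Fin n) (p : QH n) :
    horLin i a p = (0, fun s => horCoeff s i a p) := rfl

theorem hasFDerivAt_horVF (i : Fin 4) (a : Fin n) (p : QH n) :
    HasFDerivAt (horVF i a) (horLin i a) p := by
  have h : horVF i a = fun p : QH n =>
      ((fun j b => if j = i ∧ b = a then (1 : ℝ) else 0, 0) : QH n) + horLin i a p := by
    funext p
    rw [horVF_eq, horLin_apply]
    simp
  rw [h]
  exact (horLin i a).hasFDerivAt.const_add _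

theorem contDiff_horVF (i : Fin 4) (a : Fin n) : ContDiff ℝ (⊤ : ℕ∞) (horVF (n := n) i a) := by
  refine contDiff_infty_iff_fderiv.2 ⟨fun p => (hasFDerivAt_horVF i a p).differentiableAt, ?_⟩
  have h : fderiv ℝ (horVF (n := n) i a) = fun _ => horLin i a :=
    funext fun p => (hasFDerivAt_horVF i a p).fderiv
  rw [h]
  exact contDiff_const

theorem contDiff_horCoeff (s : Fin 3) (i : Fin 4) (a : Fin n) :
    ContDiff ℝ (⊤ : ℕ∞) (horCoeff (n := n) s i a) := by
  unfold horCoeff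
  fun_prop

/-- The unit vector in the vertical direction `ω_s`. -/
noncomputable def vertVec (n : ℕ) (s : Fin 3) : QH n := (0, Pi.single s 1)

theorem vertical_eq_sum (u : Fin 3 → ℝ) : ((0, u) : QH n) = ∑ s, u s • vertVec n s := by
  refine Prod.ext ?_ ?_
  · simp [vertVec, Prod.fst_sum]
  · funext r
    simp [vertVec, Prod.snd_sum, Finset.sum_apply, Pi.single_apply]

theorem horLin_vertVec (s : Fin 3) (i : Fin 4) (a : Fin n) : horLin i a (vertVec n s) = 0 := by
  refine Prod.ext rfl (funext fun r => ?_)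
  simp [horLin_apply, horCoeff, vertVec]

theorem fderiv_horCoeff_vertVec (s r : Fin 3) (i : Fin 4) (a : Fin n) (p : QH n) :
    fderiv ℝ (horCoeff s i a) p (vertVec n r) = 0 := by
  have h : horCoeff s i a =
      (ContinuousLinearMap.proj s).comp ((ContinuousLinearMap.snd ℝ _ _).comp (horLin i a)) :=
    funext fun q => by simp [horLin_apply]
  rw [h, ContinuousLinearMap.fderiv]
  simp [horLin_vertVec]

theorem horLin_horVF_sub (b c : Fin 4 × Fin n) (p : QH n) :
    horLin c.1 c.2 (horVF b.1 b.2 p) - horLin b.1 b.2 (horVF c.1 c.2 p) =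
      ∑ s, (4 * horJ s b c) • vertVec n s := by
  have h (b c : Fin 4 × Fin n) (s : Fin 3) :
      horCoeff s c.1 c.2 (horVF b.1 b.2 p) = -2 * horJ s c b := by
    simp only [horCoeff, horVF_eq, horJ]
    congr 1
    by_cases hbc : c.2 = b.2 <;> simp [hbc]
  rw [← vertical_eq_sum]
  refine Prod.ext (by simp [horLin_apply]) (funext fun s => ?_)
  simp only [horLin_apply, Prod.snd_sub, Pi.sub_apply, h]
  rw [horJ_skew s c b]
  ring

instance : (volume : Measure (QH n)).IsAddHaarMeasure := by
  have : (volume : Measure (Fin 4 → Fin n → ℝ)).IsAddHaarMeasure :=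
    Measure.pi.isAddHaarMeasure fun _ : Fin 4 => (volume : Measure (Fin n → ℝ))
  exact Measure.prod.instIsAddHaarMeasure _ _

theorem integral_horDeriv_eq_zero (i : Fin 4) (a : Fin n) {f : QH n → ℝ}
    (hf : ContDiff ℝ (⊤ : ℕ∞) f) (hsupp : HasCompactSupport f) :
    ∫ p, horDeriv i a f p = 0 := by
  let v : QH n := (fun j b => if j = i ∧ b = a then (1 : ℝ) else 0, 0)
  have hdecomp (p : QH n) : horDeriv i a f p =
      1 * fderiv ℝ f p v + ∑ s, horCoeff s i a p * fderiv ℝ f p (vertVec n s) := by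
    have h : horVF i a p = v + ∑ s, horCoeff s i a p • vertVec n s := by
      rw [← vertical_eq_sum, horVF_eq]
      simp [v]
    simp [horDeriv, h]
  have hcont (u : QH n) : Continuous fun p => fderiv ℝ f p u :=
    (hf.continuous_fderiv (by simp)).clm_apply continuous_const
  have hint {α : QH n → ℝ} (hα : ContDiff ℝ (⊤ : ℕ∞) α) (u : QH n) :
      Integrable fun p => α p * fderiv ℝ f p u :=
    (hα.continuous.mul (hcont u)).integrable_of_hasCompactSupport
      (hsupp.fderiv_apply ℝ u).mul_left
  simp_rw [hdecomp]
  rw [integral_add (hint contDiff_const v)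
      (integrable_finsetSum _ fun s _ => hint (contDiff_horCoeff s i a) _),
    integral_finsetSum _ fun s _ => hint (contDiff_horCoeff s i a) _,
    integral_mul_fderiv_eq_zero _ contDiff_const hf hsupp v (by simp)]
  simp [integral_mul_fderiv_eq_zero _ (contDiff_horCoeff _ i a) hf hsupp _
    (fderiv_horCoeff_vertVec _ _ i a)]

/-- Smooth compactly supported functions. -/
def testFn (n : ℕ) : Submodule ℝ (QH n → ℝ) where
  carrier := {f | ContDiff ℝ (⊤ : ℕ∞) f ∧ HasCompactSupport f}
  add_mem' hf hg := ⟨hf.1.add hg.1, hf.2.add hg.2⟩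
  zero_mem' := ⟨contDiff_const, HasCompactSupport.zero⟩
  smul_mem' r _ hf := ⟨hf.1.const_smul r, hf.2.smul_left (f := fun _ => r)⟩

theorem testFn_integrable_mul (f g : testFn n) : Integrable fun p => f.1 p * g.1 p :=
  (f.2.1.continuous.mul g.2.1.continuous).integrable_of_hasCompactSupport g.2.2.mul_left

/-- Differentiation of test functions along a smooth vector field. -/
noncomputable def testDeriv (w : QH n → QH n) (hw : ContDiff ℝ (⊤ : ℕ∞) w) :
    testFn n →ₗ[ℝ] testFn n where
  toFun f := ⟨fun p => fderiv ℝ f.1 p (w p),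
    (f.2.1.fderiv_right (m := (⊤ : ℕ∞)) le_rfl).clm_apply hw,
    (f.2.2.fderiv ℝ).mono fun p hp h => hp (by simp [h])⟩
  map_add' f g := Subtype.ext <| funext fun p => by
    have hf := f.2.1.differentiable (by simp) p
    have hg := g.2.1.differentiable (by simp) p
    change fderiv ℝ (f.1 + g.1) p (w p) = fderiv ℝ f.1 p (w p) + fderiv ℝ g.1 p (w p)
    rw [fderiv_add hf hg]
    rfl
  map_smul' r f := Subtype.ext <| funext fun p => by
    change fderiv ℝ (r • f.1) p (w p) = r • fderiv ℝ f.1 p (w p)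
    rw [fderiv_const_smul (f.2.1.differentiable (by simp) p)]
    rfl

/-- The horizontal derivatives as operators on test functions. -/
noncomputable def testHor (b : Fin 4 × Fin n) : testFn n →ₗ[ℝ] testFn n :=
  testDeriv (horVF b.1 b.2) (contDiff_horVF b.1 b.2)

/-- The vertical derivatives as operators on test functions. -/
noncomputable def testVert (s : Fin 3) : testFn n →ₗ[ℝ] testFn n :=
  testDeriv (fun _ => vertVec n s) contDiff_const

theorem testHor_coe (b : Fin 4 × Fin n) (f : testFn n) :
    (testHor b f).1 = horDeriv b.1 b.2 f.1 := rfl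

/-- The `L²` pairing of test functions. -/
noncomputable def testPairing (n : ℕ) : testFn n →ₗ[ℝ] testFn n →ₗ[ℝ] ℝ :=
  LinearMap.mk₂ ℝ (fun f g => ∫ p, f.1 p * g.1 p)
    (fun f g h => by
      rw [← integral_add (testFn_integrable_mul f h) (testFn_integrable_mul g h)]
      simp [add_mul])
    (fun r f g => by simp [mul_assoc, integral_const_mul])
    (fun f g h => by
      rw [← integral_add (testFn_integrable_mul f g) (testFn_integrable_mul f h)]
      simp [mul_add])
    (fun r f g => by simp [mul_left_comm, integral_const_mul])

theorem testPairing_apply (f g : testFn n) : testPairing n f g = ∫ p, f.1 p * g.1 p := rfl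

theorem testPairing_testHor (b : Fin 4 × Fin n) (f g : testFn n) :
    testPairing n (testHor b f) g = -testPairing n f (testHor b g) := by
  have h := integral_horDeriv_eq_zero b.1 b.2 (f.2.1.mul g.2.1) f.2.2.mul_right
  have hmul (p : QH n) : horDeriv b.1 b.2 (fun q => f.1 q * g.1 q) p =
      (testHor b f).1 p * g.1 p + f.1 p * (testHor b g).1 p := by
    simp only [testHor_coe, horDeriv]
    rw [fderiv_fun_mul (f.2.1.differentiable (by simp) p) (g.2.1.differentiable (by simp) p)]
    simp only [add_apply, smul_apply, smul_eq_mul]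
    ring
  simp_rw [hmul] at h
  rw [integral_add (testFn_integrable_mul _ _) (testFn_integrable_mul _ _)] at h
  exact eq_neg_of_add_eq_zero_left h

theorem testHor_commutator (b c : Fin 4 × Fin n) (f : testFn n) :
    testHor b (testHor c f) - testHor c (testHor b f) =
      (4 : ℝ) • ∑ s, horJ s b c • testVert s f := by
  refine Subtype.ext (funext fun p => ?_)
  have h := fderiv_commutator f.2.1 (hasFDerivAt_horVF b.1 b.2 p) (hasFDerivAt_horVF c.1 c.2 p)
  rw [horLin_horVF_sub, map_sum] at h
  refine h.trans ?_
  simp [testVert, testDeriv, Finset.mul_sum, mul_assoc]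

theorem testVert_testHor (s : Fin 3) (b : Fin 4 × Fin n) (f : testFn n) :
    testVert s (testHor b f) = testHor b (testVert s f) := by
  refine Subtype.ext (funext fun p => ?_)
  have h := fderiv_commutator f.2.1 (hasFDerivAt_const (vertVec n s) p)
    (hasFDerivAt_horVF b.1 b.2 p)
  rw [horLin_vertVec] at h
  exact sub_eq_zero.1 (h.trans (by simp))

theorem testPairing_trace_le (h : Fin 4 × Fin n → Fin 4 × Fin n → testFn n) :
    testPairing n (∑ b, h b b) (∑ b, h b b) ≤
      n * ∑ b, ∑ c, testPairing n (h b c) (h b c +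
        ∑ s, ∑ b', ∑ c', (horJ s b b' * horJ s c c') • h b' c') := by
  simp only [testPairing_apply]
  rw [Finset.sum_congr rfl fun b _ =>
      (integral_finsetSum _ fun c _ => testFn_integrable_mul _ _).symm,
    ← integral_finsetSum _ fun b _ => integrable_finsetSum _ fun c _ =>
      testFn_integrable_mul _ _,
    ← integral_const_mul]
  refine integral_mono (testFn_integrable_mul _ _)
    ((integrable_finsetSum _ fun b _ => integrable_finsetSum _ fun c _ =>
      testFn_integrable_mul _ _).const_mul _) fun p => ?_
  simpa [sq] using sum_trace_sq_le fun b c => (h b c).1 p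

end Heisenberg

/-- For `n > 1` and every smooth compactly supported function `f : ℝ^{4n+3} → ℝ`
on the quaternionic Heisenberg group, the full horizontal second derivatives are
controlled by the sub-Laplacian in `L²`:
`Σ_{b,c} ∫ (e_b(e_c f))² dV ≤ (1 + 1/n) ∫ (Σ_b e_b(e_b f))² dV`,
i.e. `‖∇²f‖_{L²} ≤ √(1 + 1/n) · ‖Δf‖_{L²}` where `Δf = −Σ_b e_b(e_b f)`. -/
theorem heisenberg_hessian_subLaplacian_L2_estimate
    (n : ℕ) (hn : 1 < n) (f : QH n → ℝ)
    (hf : ContDiff ℝ (⊤ : ℕ∞) f) (hsupp : HasCompactSupport f) :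
    ∑ b : Fin 4 × Fin n, ∑ c : Fin 4 × Fin n,
        ∫ p : QH n, (horDeriv b.1 b.2 (horDeriv c.1 c.2 f) p) ^ 2
      ≤ (1 + 1 / (n : ℝ)) *
        ∫ p : QH n, (∑ b : Fin 4 × Fin n, horDeriv b.1 b.2 (horDeriv b.1 b.2 f) p) ^ 2 := by
  have h := sum_hessian_sq_le (testPairing n) testHor (fun s => testVert s) hn testPairing_testHor
    horJ_skew horJ_orthogonal testHor_commutator testVert_testHor ⟨f, hf, hsupp⟩
    (testPairing_trace_le fun b c => testHor b (testHor c ⟨f, hf, hsupp⟩))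
  simp only [testPairing_apply, testHor_coe, ← sq] at h
  simpa [testHor_coe] using h
end
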